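/- arXiv:2301.08459 — 3 statements merged into one kernel-verified Lean document; each statement's English description precedes it below -/
import Mathlib

section
/- Let n ≥ 2 and d ≥ 3. An invertible linear map A ∈ GL_n(ℂ) satisfies A∘((x_1⋯x_n)^{d−2}) = (x_1⋯x_n)^{d−2} if and only if there exist a permutation σ of {1,…,n} and nonzero scalars γ_1,…,γ_n ∈ ℂ* with ∏_{i=1}^n γ_i^{d−2} = 1 such that A sends x_i to γ_i x_{σ(i)} for every i. Consequently the stabilizer of (x_1⋯x_n)^{d−2} in GL_n(ℂ) is isomorphic to (ℂ*)^{n−1} ⋊ S_n. -/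
open MvPolynomial

/-- The action of a matrix `A` on polynomials by linear substitution of the variables:
`(A ∘ f)(x) = f(Ax)`, i.e. each `x_i` is replaced by `∑_j A_{ij} x_j`. -/
noncomputable def linSubst {n : ℕ} (A : Matrix (Fin n) (Fin n) ℂ)
    (f : MvPolynomial (Fin n) ℂ) : MvPolynomial (Fin n) ℂ :=
  aeval (fun i => ∑ j : Fin n, C (A i j) * X j) f

/-- A linear form divisible by `X j` has no other coefficient. -/
theorem coeff_eq_zero_of_X_dvd_linear {n : ℕ} {a : Fin n → ℂ} {j k : Fin n} (hjk : k ≠ j)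
    (h : (X j : MvPolynomial (Fin n) ℂ) ∣ ∑ l, C (a l) * X l) : a k = 0 := by
  obtain ⟨q, hq⟩ := h
  have := congrArg (eval (Pi.single k 1)) hq
  simpa [Pi.single_apply, hjk.symm] using this

theorem linSubst_prod_X_pow {n : ℕ} (A : Matrix (Fin n) (Fin n) ℂ) (m : ℕ) :
    linSubst A ((∏ i : Fin n, X i) ^ m) = (∏ i, ∑ j, C (A i j) * X j) ^ m := by
  simp [linSubst]

theorem linSubst_prod_X_pow_of_monomial {n : ℕ} {A : Matrix (Fin n) (Fin n) ℂ}
    {σ : Equiv.Perm (Fin n)} {γ : Fin n → ℂ} (hA : ∀ i j, A i j = if j = σ i then γ i else 0)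
    (m : ℕ) :
    linSubst A ((∏ i : Fin n, X i) ^ m) = C (∏ i, γ i ^ m) * (∏ i, X i) ^ m := by
  have hrow (i : Fin n) : (∑ j, C (A i j) * X j : MvPolynomial (Fin n) ℂ) =
      C (γ i) * X (σ i) := by
    rw [Finset.sum_eq_single (σ i)]
    · simp [hA]
    · intro j _ hj
      simp [hA, hj]
    · simp
  rw [linSubst_prod_X_pow]
  simp_rw [hrow]
  rw [Finset.prod_mul_distrib, Equiv.prod_comp σ (fun i => (X i : MvPolynomial (Fin n) ℂ)),
    mul_pow, Finset.prod_pow, map_pow, map_prod]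

/-- An invertible matrix whose substitution fixes a positive power of `∏ X i` is monomial. -/
theorem exists_perm_of_linSubst_prod_X_pow_eq {n m : ℕ} (hm : m ≠ 0) (A : GL (Fin n) ℂ)
    (h : linSubst (A : Matrix (Fin n) (Fin n) ℂ) ((∏ i : Fin n, X i) ^ m) =
      (∏ i : Fin n, X i) ^ m) :
    ∃ (σ : Equiv.Perm (Fin n)) (γ : Fin n → ℂ), (∀ i, γ i ≠ 0) ∧
      ∀ i j, (A : Matrix (Fin n) (Fin n) ℂ) i j = if j = σ i then γ i else 0 := by
  have hrow (i : Fin n) : ¬ ∀ k, (A : Matrix (Fin n) (Fin n) ℂ) i k = 0 := fun h0 =>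
    A.det_ne_zero (Matrix.det_eq_zero_of_row_eq_zero i h0)
  have hdvd (j : Fin n) : ∃ i, ∀ k, k ≠ j → (A : Matrix (Fin n) (Fin n) ℂ) i k = 0 := by
    have hX : Prime (X j : MvPolynomial (Fin n) ℂ) := X_prime
    have hj : (X j : MvPolynomial (Fin n) ℂ) ∣
        (∏ i, ∑ l, C ((A : Matrix (Fin n) (Fin n) ℂ) i l) * X l) ^ m := by
      rw [← linSubst_prod_X_pow, h]
      exact dvd_pow (Finset.dvd_prod_of_mem _ (Finset.mem_univ j)) hm
    obtain ⟨i, -, hi⟩ := (hX.dvd_finsetProd_iff _).1 (hX.dvd_of_dvd_pow hj)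
    exact ⟨i, fun k hk => coeff_eq_zero_of_X_dvd_linear hk hi⟩
  choose τ hτ using hdvd
  have hinj : Function.Injective τ := by
    intro j j' hjj
    by_contra hne
    refine hrow (τ j) fun k => ?_
    by_cases hk : k = j
    · rw [hjj]
      exact hτ j' k (hk ▸ hne)
    · exact hτ j k hk
  let e : Equiv.Perm (Fin n) := Equiv.ofBijective τ (Finite.injective_iff_bijective.1 hinj)
  have hzero (i j : Fin n) (hj : j ≠ e.symm i) : (A : Matrix (Fin n) (Fin n) ℂ) i j = 0 := by
    have := hτ (e.symm i) j hj
    rwa [show τ (e.symm i) = i from e.apply_symm_apply i] at this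
  refine ⟨e.symm, fun i => (A : Matrix (Fin n) (Fin n) ℂ) i (e.symm i), fun i hi => ?_,
    fun i j => ?_⟩
  · refine hrow i fun k => ?_
    by_cases hk : k = e.symm i
    · rw [hk]
      exact hi
    · exact hzero i k hk
  · split_ifs with hj
    · rw [hj]
    · exact hzero i j hj

/-- For `n ≥ 2` and `d ≥ 3`, an invertible matrix `A ∈ GL_n(ℂ)` stabilizes
`(x_1⋯x_n)^{d-2}` if and only if there are a permutation `σ` and nonzero scalars
`γ_1,…,γ_n` with `∏ γ_i^{d-2} = 1` such that `A` sends `x_i` to `γ_i x_{σ(i)}`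
(i.e. `A_{ij} = γ_i` if `j = σ(i)` and `0` otherwise); consequently the stabilizer
is isomorphic to `(ℂ*)^{n-1} ⋊ S_n`. -/
theorem stabilizer_of_power_of_product (n d : ℕ) (hn : 2 ≤ n) (hd : 3 ≤ d)
    (A : GL (Fin n) ℂ) :
    linSubst (A : Matrix (Fin n) (Fin n) ℂ) ((∏ i : Fin n, X i) ^ (d - 2)) =
        (∏ i : Fin n, X i) ^ (d - 2) ↔
      ∃ (σ : Equiv.Perm (Fin n)) (γ : Fin n → ℂ),
        (∀ i, γ i ≠ 0) ∧ (∏ i : Fin n, γ i ^ (d - 2)) = 1 ∧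
        ∀ i j, (A : Matrix (Fin n) (Fin n) ℂ) i j = if j = σ i then γ i else 0 := by
  constructor
  · intro h
    obtain ⟨σ, γ, hγ, hA⟩ := exists_perm_of_linSubst_prod_X_pow_eq (by omega) A h
    refine ⟨σ, γ, hγ, ?_, hA⟩
    rw [linSubst_prod_X_pow_of_monomial hA] at h
    simpa using congrArg (eval 1) h
  · rintro ⟨σ, γ, -, hprod, hA⟩
    rw [linSubst_prod_X_pow_of_monomial hA, hprod, C_1, one_mul]
end

section
/- Let n ≥ 2 and d ≥ 3 with n dividing d, and let f ∈ ℂ[x_1,…,x_n] be homogeneous of degree d with H(f) = α·(x_1⋯x_n)^{d−2} for some nonzero α ∈ ℂ. Then f = β·(x_1⋯x_n)^{d/n} or f = β·(x_1^d + ⋯ + x_n^d) for some β ∈ ℂ if and only if f is invariant under the group G(d,n,n), i.e. f(θ^{a_1}x_{σ(1)},…,θ^{a_n}x_{σ(n)}) = f(x_1,…,x_n) for every permutation σ of {1,…,n} and all integers a_1,…,a_n with a_1+⋯+a_n ≡ 0 (mod n), where θ is a primitive d-th root of unity. -/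
open MvPolynomial

/-- The Hessian determinant of a multivariate polynomial. -/
noncomputable def hessDet {n : ℕ} (f : MvPolynomial (Fin n) ℂ) : MvPolynomial (Fin n) ℂ :=
  Matrix.det (Matrix.of fun i j => pderiv i (pderiv j f))

namespace MvPolynomial

variable {σ : Type*} [Fintype σ]

theorem coeff_aeval_C_mul_X {R : Type*} [CommSemiring R] (c : σ → R) (f : MvPolynomial σ R)
    (m : σ →₀ ℕ) :
    coeff m (aeval (fun i => C (c i) * X i : σ → MvPolynomial σ R) f) =
      (∏ i, c i ^ m i) * coeff m f := by
  classical
  induction f using MvPolynomial.induction_on' with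
  | monomial s a =>
    have key : aeval (fun i => C (c i) * X i : σ → MvPolynomial σ R) (monomial s a) =
        monomial s (a * ∏ i, c i ^ s i) := by
      rw [aeval_monomial, algebraMap_eq, Finsupp.prod_fintype _ _ (fun i => pow_zero _),
        monomial_eq, Finsupp.prod_fintype _ _ (fun i => pow_zero _)]
      simp only [mul_pow, Finset.prod_mul_distrib, map_mul, map_prod, map_pow]
      ring
    rw [key, coeff_monomial, coeff_monomial]
    split_ifs with h
    · rw [h, mul_comm]
    · rw [mul_zero]
  | add p q hp hq => rw [map_add, coeff_add, hp, hq, coeff_add, mul_add]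

theorem prod_X_pow_univ_eq_monomial (k : ℕ) :
    (∏ i : σ, (X i : MvPolynomial σ ℂ)) ^ k =
      monomial (Finsupp.equivFunOnFinite.symm fun _ => k) 1 := by
  rw [monomial_eq, Finsupp.prod_fintype _ _ (fun i => pow_zero _), C_1, one_mul]
  simp [Finset.prod_pow]

theorem X_mul_pderiv_prod_X_pow (k : ℕ) (j : σ) :
    X j * pderiv j ((∏ i : σ, (X i : MvPolynomial σ ℂ)) ^ k) =
      C (k : ℂ) * (∏ i : σ, X i) ^ k := by
  classical
  rw [prod_X_pow_univ_eq_monomial, pderiv_monomial, X, monomial_mul, C_mul_monomial]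
  rcases Nat.eq_zero_or_pos k with rfl | hk
  · simp
  · simp only [Finsupp.equivFunOnFinite_symm_apply_apply, one_mul, mul_one]
    congr 2
    ext l
    by_cases h : j = l
    · subst h; simp; omega
    · simp [Ne.symm h]

/-- The Hessian entries of `b ∑ Xᵢᵈ + g (∏ Xᵢ)ᵏ`, scaled by the coordinates. -/
theorem mul_eval_hessian [DecidableEq σ] (d k : ℕ) (hd : 2 ≤ d) (b g : ℂ) (x : σ → ℂ) (i j : σ) :
    x i * x j * eval x (pderiv i (pderiv j
      (C b * ∑ l : σ, X l ^ d + C g * (∏ l : σ, X l) ^ k))) =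
    (if i = j then b * d * (d - 1) * x i ^ d - g * k * (∏ l, x l) ^ k else 0) +
      g * k * k * (∏ l, x l) ^ k := by
  have hP (j : σ) := X_mul_pderiv_prod_X_pow (σ := σ) k j
  have hS : pderiv i (pderiv j (∑ l : σ, (X l : MvPolynomial σ ℂ) ^ d)) =
      if i = j then C ((d : ℂ) * (d - 1)) * X i ^ (d - 2) else 0 := by
    have h1 : pderiv j (∑ l : σ, (X l : MvPolynomial σ ℂ) ^ d) = C (d : ℂ) * X j ^ (d - 1) := by
      rw [map_sum, Finset.sum_eq_single j]
      · simp
      · intro l _ hl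
        simp [pderiv_X_of_ne hl]
      · simp
    rw [h1, pderiv_C_mul, pderiv_pow]
    split_ifs with h
    · subst h
      obtain ⟨e, rfl⟩ := Nat.exists_eq_add_of_le' hd
      have hC : (C ((e + 2 : ℕ) - 1 : ℂ) : MvPolynomial σ ℂ) = (e + 1 : ℕ) := by
        rw [← map_natCast (C : ℂ →+* MvPolynomial σ ℂ)]
        push_cast
        ring_nf
      rw [C_mul, hC, pderiv_X_self]
      simp only [Nat.add_sub_cancel, show e + 2 - 1 = e + 1 by omega]
      ring
    · rw [pderiv_X_of_ne (Ne.symm h)]; simp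
  have hev : (∏ l, x l) ^ k = eval x ((∏ l : σ, X l) ^ k) := by simp
  rw [hev]
  generalize (∏ l : σ, (X l : MvPolynomial σ ℂ)) ^ k = P at hP
  have hPi := congrArg (eval x) (hP i)
  have hPij := congrArg (fun p => eval x (pderiv i p)) (hP j)
  simp only [map_add, hS, Derivation.leibniz, smul_eq_mul, map_mul, eval_X,
    eval_C, pderiv_C, mul_zero, add_zero] at hPi hPij ⊢
  obtain ⟨e, rfl⟩ := Nat.exists_eq_add_of_le' hd
  by_cases h : i = j
  · subst h
    simp only [pderiv_X_self, map_one, if_true, eval_C, map_mul, map_pow, eval_X,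
      Nat.add_sub_cancel] at hPij ⊢
    linear_combination g * x i * hPij + g * (k - 1) * hPi
  · simp only [pderiv_X_of_ne (Ne.symm h), map_zero, if_neg h] at hPij ⊢
    linear_combination g * x i * hPij + g * k * hPi

end MvPolynomial

theorem eval_hessDet {n : ℕ} (f : MvPolynomial (Fin n) ℂ) (x : Fin n → ℂ) :
    eval x (hessDet f) = (Matrix.of fun i j => eval x (pderiv i (pderiv j f))).det := by
  rw [hessDet, RingHom.map_det]
  rfl

theorem eq_of_invariant {n d : ℕ} (hn : 2 ≤ n) (hd : 0 < d) (hnd : n ∣ d)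
    {θ : ℂ} (hθ : IsPrimitiveRoot θ d)
    {f : MvPolynomial (Fin n) ℂ} (hf : f.IsHomogeneous d)
    (h : ∀ (σ : Equiv.Perm (Fin n)) (a : Fin n → ℕ), n ∣ (∑ i, a i) →
      aeval (fun i => C (θ ^ a i) * X (σ i)) f = f) :
    ∃ b g : ℂ, f = C b * ∑ l, X l ^ d + C g * (∏ l, X l) ^ (d / n) := by
  classical
  obtain ⟨k, rfl⟩ := hnd
  have hn0 : 0 < n := by omega
  have hk : 0 < k := Nat.pos_of_mul_pos_left hd
  rw [Nat.mul_div_cancel_left _ hn0]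
  have hcong (m : Fin n →₀ ℕ) (hm : coeff m f ≠ 0) (i j : Fin n) (hij : i ≠ j) :
      m i ≡ m j [MOD n * k] := by
    have h1 := h 1 (Pi.single i 1 + Pi.single j (n * k - 1)) (by
      simp only [Pi.add_apply, Finset.sum_add_distrib, Finset.sum_pi_single', Finset.mem_univ,
        if_true]
      rw [Nat.add_sub_cancel' hd]
      exact dvd_mul_right _ _)
    have h2 := congrArg (coeff m) h1
    simp only [Equiv.Perm.coe_one, id] at h2
    rw [coeff_aeval_C_mul_X] at h2
    have h3 := mul_right_cancel₀ hm (h2.trans (one_mul _).symm)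
    simp only [← pow_mul, Finset.prod_pow_eq_pow_sum, Pi.add_apply, add_mul,
      Finset.sum_add_distrib, Pi.single_apply, ite_mul, zero_mul, Finset.sum_ite_eq',
      Finset.mem_univ, if_true, one_mul] at h3
    have h4 := (hθ.pow_eq_one_iff_dvd _).1 h3
    have h5 : m i + (n * k - 1) * m j ≡ m j + (n * k - 1) * m j [MOD n * k] := by
      have : m j + (n * k - 1) * m j = n * k * m j := by
        obtain ⟨e, he⟩ := Nat.exists_eq_add_of_le' hd
        rw [he]; simp; ring
      rw [this]
      exact ((Nat.modEq_zero_iff_dvd.2 h4)).trans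
        (Nat.modEq_zero_iff_dvd.2 (dvd_mul_right _ _)).symm
    exact Nat.ModEq.add_right_cancel' _ h5
  have hsum (m : Fin n →₀ ℕ) (hm : coeff m f ≠ 0) : ∑ i, m i = n * k := by
    have := hf hm
    rwa [Finsupp.weight_apply, Finsupp.sum_fintype _ _ (by simp),
      Finset.sum_congr rfl (fun i _ => by simp : ∀ i ∈ Finset.univ, _ = m i)] at this
  have hsymm (i j : Fin n) : coeff (Finsupp.single i (n * k)) f =
      coeff (Finsupp.single j (n * k)) f := by
    have h1 := h (Equiv.swap i j) 0 (by simp)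
    simp only [Pi.zero_apply, pow_zero, C_1, one_mul] at h1
    have h2 : rename (Equiv.swap i j) f = f := by rw [rename_eq_aeval]; exact h1
    conv_rhs => rw [← h2]
    have := coeff_rename_mapDomain _ (Equiv.swap i j).injective f (Finsupp.single i (n * k))
    rw [Finsupp.mapDomain_single, Equiv.swap_apply_left] at this
    exact this.symm
  let i0 : Fin n := ⟨0, hn0⟩
  have hlt : k < n * k := by nlinarith
  have hne (i : Fin n) : Finsupp.single i (n * k) ≠
      Finsupp.equivFunOnFinite.symm fun _ : Fin n => k := by
    intro e
    have := DFunLike.congr_fun e i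
    simp at this
    omega
  refine ⟨coeff (Finsupp.single i0 (n * k)) f,
    coeff (Finsupp.equivFunOnFinite.symm fun _ => k) f, ?_⟩
  ext m
  rw [coeff_add, coeff_C_mul, coeff_C_mul, prod_X_pow_univ_eq_monomial, coeff_monomial, coeff_sum]
  simp only [coeff_X_pow]
  by_cases hs : ∃ i, Finsupp.single i (n * k) = m
  · obtain ⟨i, rfl⟩ := hs
    rw [if_neg (hne i).symm, Finset.sum_eq_single i]
    · rw [if_pos rfl, mul_one, mul_zero, add_zero, hsymm i i0]
    · intro j _ hj
      rw [if_neg]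
      exact fun e => hj (Finsupp.single_left_injective (by omega) e)
    · simp
  · rw [Finset.sum_eq_zero (fun i _ => if_neg fun e => hs ⟨i, e⟩)]
    split_ifs with hc
    · rw [← hc]; simp
    · by_contra hm
      simp only [mul_zero, add_zero] at hm
      have hle (i : Fin n) : m i ≤ n * k := by
        rw [← hsum m hm]
        exact Finset.single_le_sum (fun _ _ => Nat.zero_le _) (Finset.mem_univ i)
      have hmlt (i : Fin n) : m i < n * k := by
        refine lt_of_le_of_ne (hle i) fun e => hs ⟨i, ?_⟩
        have h1 := hsum m hm
        rw [← Finset.add_sum_erase _ _ (Finset.mem_univ i), e] at h1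
        have h2 : ∑ x ∈ Finset.univ.erase i, m x = 0 := by omega
        rw [Finset.sum_eq_zero_iff] at h2
        ext j
        by_cases hj : i = j
        · subst hj; simp [e]
        · rw [Finsupp.single_eq_of_ne (Ne.symm hj), h2 j (by simp [Ne.symm hj])]
      have heq (i : Fin n) : m i = m i0 := by
        by_cases hi : i = i0
        · rw [hi]
        · exact Nat.ModEq.eq_of_lt_of_lt (hcong m hm i i0 hi) (hmlt i) (hmlt i0)
      have h1 := hsum m hm
      rw [Finset.sum_congr rfl fun i _ => heq i] at h1
      simp at h1
      apply hc
      ext i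
      simp only [Finsupp.equivFunOnFinite_symm_apply_apply, heq i]
      rcases h1 with h1 | h1
      · exact h1.symm
      · omega

theorem exists_ne_zero_pow_eq {k : ℕ} (hk : 0 < k) {z : ℂ} (hz : z ≠ 0) :
    ∃ t : ℂ, t ≠ 0 ∧ t ^ k = z := by
  obtain ⟨t, ht⟩ := IsAlgClosed.exists_pow_nat_eq z hk
  exact ⟨t, fun h => hz (by rw [← ht, h, zero_pow hk.ne']), ht⟩

theorem eq_zero_or_eq_zero_of_hessDet {n k : ℕ} (hn : 2 ≤ n) (hd : 3 ≤ n * k)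
    {b g α : ℂ} (hα : α ≠ 0)
    (hH : hessDet (C b * ∑ l : Fin n, X l ^ (n * k) + C g * (∏ l : Fin n, X l) ^ k) =
      C α * (∏ i : Fin n, X i) ^ (n * k - 2)) : b = 0 ∨ g = 0 := by
  by_contra! hbg
  obtain ⟨hb, hg⟩ := hbg
  have hk : 0 < k := Nat.pos_of_ne_zero (by rintro rfl; simp at hd)
  have hkC : (k : ℂ) ≠ 0 := by exact_mod_cast hk.ne'
  have hdC : ((n * k : ℕ) : ℂ) ≠ 0 := by norm_cast; omega
  have hdC1 : ((n * k : ℕ) : ℂ) - 1 ≠ 0 := by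
    rw [sub_ne_zero]; norm_cast; omega
  have hM (x : Fin n → ℂ) := congrArg (eval x) hH
  simp only [eval_hessDet, map_mul, eval_C, map_pow, map_prod, eval_X] at hM
  have hE (x : Fin n → ℂ) (i j : Fin n) :=
    mul_eval_hessian (n * k) k (by omega) b g x i j
  rcases Nat.lt_or_ge n 3 with h3 | h3
  · obtain rfl : n = 2 := by omega
    obtain ⟨t, ht0, ht⟩ := exists_ne_zero_pow_eq hk (z := -1) (by norm_num)
    have ht2 : t ^ (2 * k) = 1 := by rw [mul_comm, pow_mul, ht]; norm_num
    have hdet (x : Fin 2 → ℂ) := by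
      have h1 := hM x
      rw [Matrix.det_fin_two] at h1
      simp only [Matrix.of_apply] at h1
      have h2 := congrArg (· * (x 0 * x 1) ^ 2) h1
      simp only [Fin.prod_univ_two x, mul_assoc, ← pow_add,
        Nat.sub_add_cancel (by omega : 2 ≤ 2 * k)] at h2
      have h3 := congrArg₂ (· - ·) (congrArg₂ (· * ·) (hE x 0 0) (hE x 1 1))
        (congrArg₂ (· * ·) (hE x 0 1) (hE x 1 0))
      exact (h3.symm.trans (by ring)).trans h2
    have hM1 := hdet ![1, 1]
    have hM2 := hdet ![t, 1]
    simp [Fin.prod_univ_two, ht, ht2] at hM1 hM2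
    push_cast at hdC hdC1
    have hk1 : (k : ℂ) - 1 ≠ 0 := by
      rw [sub_ne_zero]; norm_cast; omega
    refine mul_ne_zero
      (mul_ne_zero (mul_ne_zero (mul_ne_zero (mul_ne_zero hb hdC) hdC1) hg) hkC) hk1 ?_
    linear_combination (hM1 - hM2) / 4
  · let i0 : Fin n := ⟨0, by omega⟩
    let i1 : Fin n := ⟨1, by omega⟩
    let i2 : Fin n := ⟨2, by omega⟩
    have h10 : i1 ≠ i0 := by simp [i0, i1]
    have h20 : i2 ≠ i0 := by simp [i0, i2]
    have h12 : i1 ≠ i2 := by simp [i1, i2]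
    obtain ⟨t, ht0, ht⟩ := exists_ne_zero_pow_eq hk
      (z := b * (n * k : ℕ) * ((n * k : ℕ) - 1) / (g * k))
      (div_ne_zero (mul_ne_zero (mul_ne_zero hb hdC) hdC1) (mul_ne_zero hg hkC))
    rw [eq_div_iff (mul_ne_zero hg hkC)] at ht
    set x : Fin n → ℂ := Function.update 1 i0 t with hx
    have hprod : ∏ i, x i = t := by
      rw [hx, Finset.prod_update_of_mem (Finset.mem_univ _)]
      simp
    have hx0 (i : Fin n) : x i ≠ 0 := by
      by_cases h : i = i0
      · subst h; simpa [hx] using ht0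
      · simp [hx, h]
    have hrow (i : Fin n) (hi : i ≠ i0) (j : Fin n) :
        x j * eval x (pderiv i (pderiv j
          (C b * ∑ l : Fin n, X l ^ (n * k) + C g * (∏ l : Fin n, X l) ^ k))) =
        g * k * k * t ^ k := by
      have h1 := mul_eval_hessian (n * k) k (by omega) b g x i j
      have hxi : x i = 1 := by simp [hx, hi]
      rw [hprod, hxi, one_pow, mul_one, one_mul] at h1
      rw [h1, add_eq_right]
      split_ifs
      · linear_combination -ht
      · rfl
    have hdet := hM x
    rw [Matrix.det_zero_of_row_eq h12, hprod] at hdet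
    · exact mul_ne_zero hα (pow_ne_zero _ ht0) hdet.symm
    · ext j
      exact mul_left_cancel₀ (hx0 j) ((hrow i1 h10 j).trans (hrow i2 h20 j).symm)

/-- For `n ≥ 2`, `d ≥ 3` with `n ∣ d`, and `f` homogeneous of degree `d` with
`H(f) = α(x_1⋯x_n)^{d-2}`, `α ≠ 0`: `f = β(x_1⋯x_n)^{d/n}` or `f = β(x_1^d+⋯+x_n^d)`
if and only if `f` is invariant under the reflection group `G(d,n,n)`, i.e.
`f(θ^{a_1}x_{σ(1)},…,θ^{a_n}x_{σ(n)}) = f` for every permutation `σ` and all exponents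
`a_i` with `n ∣ a_1+⋯+a_n`, where `θ` is a primitive `d`-th root of unity. -/
theorem gdnn_invariance (n d : ℕ) (hn : 2 ≤ n) (hd : 3 ≤ d) (hnd : n ∣ d)
    (θ : ℂ) (hθ : IsPrimitiveRoot θ d)
    (f : MvPolynomial (Fin n) ℂ) (hf : f.IsHomogeneous d)
    (α : ℂ) (hα : α ≠ 0) (hH : hessDet f = C α * (∏ i : Fin n, X i) ^ (d - 2)) :
    ((∃ β : ℂ, f = C β * (∏ i : Fin n, X i) ^ (d / n)) ∨
      (∃ β : ℂ, f = C β * ∑ i : Fin n, X i ^ d)) ↔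
    (∀ (σ : Equiv.Perm (Fin n)) (a : Fin n → ℕ), n ∣ (∑ i, a i) →
      aeval (fun i => C (θ ^ a i) * X (σ i)) f = f) := by
  constructor
  · rintro (⟨β, rfl⟩ | ⟨β, rfl⟩) σ a ha
    · simp only [map_mul, map_pow, map_prod, aeval_X, algHom_C, algebraMap_eq]
      rw [Finset.prod_mul_distrib, Equiv.prod_comp σ (fun i => (X i : MvPolynomial (Fin n) ℂ)),
        mul_pow, Finset.prod_pow_eq_pow_sum, ← pow_mul, ← map_pow,
        (hθ.pow_eq_one_iff_dvd _).2, C_1, one_mul]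
      rw [← Nat.mul_div_assoc _ hnd, mul_comm, Nat.mul_div_assoc _ ha]
      exact dvd_mul_right _ _
    · simp only [map_mul, map_pow, map_sum, aeval_X, algHom_C, algebraMap_eq, mul_pow]
      rw [← Equiv.sum_comp σ (fun i => (X i : MvPolynomial (Fin n) ℂ) ^ d)]
      congr 1
      refine Finset.sum_congr rfl fun i _ => ?_
      rw [← C_pow, ← C_pow, ← pow_mul, mul_comm (a i), pow_mul, hθ.pow_eq_one, one_pow,
        C_1, one_mul]
  · intro h
    obtain ⟨b, g, rfl⟩ := eq_of_invariant hn (by omega) hnd hθ hf h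
    obtain ⟨k, rfl⟩ := hnd
    rw [Nat.mul_div_cancel_left _ (by omega)] at hH ⊢
    rcases eq_zero_or_eq_zero_of_hessDet hn hd hα hH with rfl | rfl
    · exact Or.inl ⟨g, by simp⟩
    · exact Or.inr ⟨b, by simp⟩
end

section
/- Let d ≥ 3 and let f ∈ ℂ[x_1,x_2] be a homogeneous polynomial of degree d with nonzero Hessian determinant H(f) ≠ 0. Then the kernel of the differential dH_f of the Hessian map at f, restricted to homogeneous binary forms of degree d, has dimension at most 1, unless d = 2m² for some integer m and f = ℓ_1^{m²}ℓ_2^{m²} for two linearly independent linear forms ℓ_1, ℓ_2; in the latter case dim Ker(dH_f) = 2. -/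
open MvPolynomial

/-- The differential of the Hessian map at a binary form `f`:
`dH_f(g) = g_{11}f_{22} + f_{11}g_{22} - 2f_{12}g_{12}`. -/
noncomputable def dH2 (f : MvPolynomial (Fin 2) ℂ) :
    MvPolynomial (Fin 2) ℂ →ₗ[ℂ] MvPolynomial (Fin 2) ℂ :=
  (LinearMap.mulLeft ℂ (pderiv 1 (pderiv 1 f))).comp
      ((pderiv (R := ℂ) (0 : Fin 2)).toLinearMap.comp (pderiv 0).toLinearMap)
  + (LinearMap.mulLeft ℂ (pderiv 0 (pderiv 0 f))).comp
      ((pderiv (R := ℂ) (1 : Fin 2)).toLinearMap.comp (pderiv 1).toLinearMap)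
  - (LinearMap.mulLeft ℂ (2 * pderiv 0 (pderiv 1 f))).comp
      ((pderiv (R := ℂ) (0 : Fin 2)).toLinearMap.comp (pderiv 1).toLinearMap)

/-- The kernel of the differential of the Hessian map at `f`, restricted to homogeneous
binary forms of degree `d`. -/
noncomputable def kerDH2 (d : ℕ) (f : MvPolynomial (Fin 2) ℂ) :
    Submodule ℂ (MvPolynomial (Fin 2) ℂ) :=
  homogeneousSubmodule (Fin 2) ℂ d ⊓ LinearMap.ker (dH2 f)

open scoped Polynomial

/-! ### Dehomogenization of binary forms -/

/-- The dehomogenization `f(x₁, x₂) ↦ f(X, 1)` of a bivariate polynomial. -/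
noncomputable def dehom : MvPolynomial (Fin 2) ℂ →ₐ[ℂ] ℂ[X] :=
  aeval ![Polynomial.X, 1]

@[simp] lemma dehom_X_zero : dehom (X 0) = Polynomial.X := by simp [dehom]

@[simp] lemma dehom_X_one : dehom (X 1) = 1 := by simp [dehom]

@[simp] lemma dehom_C (c : ℂ) : dehom (C c) = Polynomial.C c := by
  simp [dehom]

lemma dehom_eq_sum (f : MvPolynomial (Fin 2) ℂ) :
    dehom f = ∑ m ∈ f.support, Polynomial.C (coeff m f) * Polynomial.X ^ (m 0) := by
  simp [dehom, aeval_def, eval₂_eq', Fin.prod_univ_two]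

lemma coeff_dehom {f : MvPolynomial (Fin 2) ℂ} {d : ℕ} (hf : f.IsHomogeneous d)
    {m : Fin 2 →₀ ℕ} (hm : m.degree = d) : (dehom f).coeff (m 0) = coeff m f := by
  rw [dehom_eq_sum, Polynomial.finsetSum_coeff, Finset.sum_eq_single m]
  · simp
  · intro n hn hnm
    rw [Polynomial.coeff_C_mul_X_pow, if_neg]
    intro h
    have hnd : n.degree = d := by
      by_contra hne
      exact (mem_support_iff.mp hn) (hf.coeff_eq_zero hne)
    rw [Finsupp.degree_eq_sum, Fin.sum_univ_two] at hm hnd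
    apply hnm
    ext i
    fin_cases i
    · exact h.symm
    · change n 1 = m 1
      omega
  · intro h
    simp [notMem_support_iff.mp h]

lemma eq_zero_of_dehom_eq_zero {f : MvPolynomial (Fin 2) ℂ} {d : ℕ} (hf : f.IsHomogeneous d)
    (h : dehom f = 0) : f = 0 := by
  ext m
  by_cases hm : m.degree = d
  · rw [← coeff_dehom hf hm, h]; simp
  · rw [hf.coeff_eq_zero hm]; simp

lemma eq_of_dehom_eq {f g : MvPolynomial (Fin 2) ℂ} {d : ℕ} (hf : f.IsHomogeneous d)
    (hg : g.IsHomogeneous d) (h : dehom f = dehom g) : f = g :=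
  sub_eq_zero.mp (eq_zero_of_dehom_eq_zero (hf.sub hg) (by rw [map_sub, h, sub_self]))

lemma natDegree_dehom_le {f : MvPolynomial (Fin 2) ℂ} {d : ℕ} (hf : f.IsHomogeneous d) :
    (dehom f).natDegree ≤ d := by
  rw [dehom_eq_sum]
  refine Polynomial.natDegree_sum_le_of_forall_le _ _ fun m hm => ?_
  refine (Polynomial.natDegree_C_mul_X_pow_le _ _).trans ?_
  have hmd : m.degree = d := by
    by_contra hne
    exact (mem_support_iff.mp hm) (hf.coeff_eq_zero hne)
  rw [Finsupp.degree_eq_sum, Fin.sum_univ_two] at hmd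
  omega

lemma dehom_pderiv_zero (f : MvPolynomial (Fin 2) ℂ) :
    dehom (pderiv 0 f) = Polynomial.derivative (dehom f) := by
  induction f using MvPolynomial.induction_on with
  | C a => simp
  | add p q hp hq => simp [hp, hq]
  | mul_X p i hp =>
    fin_cases i
    · simp [Derivation.leibniz, hp, pderiv_X]; ring
    · simp [Derivation.leibniz, hp, pderiv_X]

lemma dehom_pderiv_one {f : MvPolynomial (Fin 2) ℂ} {d : ℕ} (hf : f.IsHomogeneous d) :
    dehom (pderiv 1 f) = (d : ℂ[X]) * dehom f - Polynomial.X * Polynomial.derivative (dehom f) := by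
  have h := congrArg dehom hf.sum_X_mul_pderiv
  simp only [Fin.sum_univ_two, map_add, map_mul, dehom_X_zero, dehom_X_one, one_mul,
    dehom_pderiv_zero, nsmul_eq_mul, map_natCast] at h
  linear_combination h

/-! ### The second transvectant in one variable -/

/-- The equation `d (F G'' + F'' G) = 2 (d - 1) F' G'`, which is the vanishing of the second
transvectant of two binary forms of degree `d` with dehomogenizations `F` and `G`. -/
def TransvectantZero (d : ℕ) (F G : ℂ[X]) : Prop :=
  (d : ℂ[X]) * (F * G.derivative.derivative + F.derivative.derivative * G) =
    2 * (d - 1) * (F.derivative * G.derivative)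

lemma dehom_dH2 {d : ℕ} (hd : 1 ≤ d) {f g : MvPolynomial (Fin 2) ℂ} (hf : f.IsHomogeneous d)
    (hg : g.IsHomogeneous d) :
    dehom (dH2 f g) = (d - 1) * (d * (dehom f * (dehom g).derivative.derivative +
      (dehom f).derivative.derivative * dehom g) -
        2 * (d - 1) * ((dehom f).derivative * (dehom g).derivative)) := by
  simp only [dH2, LinearMap.sub_apply, LinearMap.add_apply, LinearMap.comp_apply,
    LinearMap.mulLeft_apply, Derivation.coeFn_coe, map_sub, map_add,
    map_mul, dehom_pderiv_zero, dehom_pderiv_one hf, dehom_pderiv_one hg,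
    dehom_pderiv_one hf.pderiv, dehom_pderiv_one hg.pderiv, Polynomial.derivative_mul,
    Polynomial.derivative_X, Polynomial.derivative_natCast, map_ofNat, Nat.cast_sub hd,
    Nat.cast_one]
  ring

lemma dehom_hessDet {d : ℕ} (hd : 1 ≤ d) {f : MvPolynomial (Fin 2) ℂ} (hf : f.IsHomogeneous d) :
    dehom (hessDet f) = (d - 1) * (d * (dehom f * (dehom f).derivative.derivative) -
        (d - 1) * (dehom f).derivative ^ 2) := by
  simp only [hessDet, Matrix.det_fin_two, Matrix.of_apply, map_sub,
    map_mul, dehom_pderiv_zero, dehom_pderiv_one hf,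
    dehom_pderiv_one hf.pderiv, Polynomial.derivative_mul,
    Polynomial.derivative_X, Polynomial.derivative_natCast, Nat.cast_sub hd,
    Nat.cast_one]
  ring

lemma isHomogeneous_hessDet {d : ℕ} {f : MvPolynomial (Fin 2) ℂ} (hf : f.IsHomogeneous d) :
    (hessDet f).IsHomogeneous ((d - 1 - 1) + (d - 1 - 1)) := by
  rw [hessDet, Matrix.det_fin_two]
  exact (hf.pderiv.pderiv.mul hf.pderiv.pderiv).sub (hf.pderiv.pderiv.mul hf.pderiv.pderiv)

lemma mem_kerDH2_iff {d : ℕ} {f g : MvPolynomial (Fin 2) ℂ} :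
    g ∈ kerDH2 d f ↔ g.IsHomogeneous d ∧ dH2 f g = 0 := by
  simp [kerDH2]

lemma natCast_sub_one_ne_zero {d : ℕ} (hd : 2 ≤ d) : (d - 1 : ℂ[X]) ≠ 0 := by
  rw [sub_ne_zero]
  exact_mod_cast (by omega : d ≠ 1)

lemma transvectantZero_of_mem_kerDH2 {d : ℕ} (hd : 2 ≤ d) {f g : MvPolynomial (Fin 2) ℂ}
    (hf : f.IsHomogeneous d) (hg : g ∈ kerDH2 d f) : TransvectantZero d (dehom f) (dehom g) := by
  rw [mem_kerDH2_iff] at hg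
  have h := dehom_dH2 (by omega) hf hg.1
  rw [hg.2, map_zero] at h
  exact sub_eq_zero.mp ((mul_eq_zero.mp h.symm).resolve_left (natCast_sub_one_ne_zero hd))

/-! ### Local exponents -/

/-- The Euler operator `(X - c) d/dX` at `c`. -/
noncomputable def eulerAt (c : ℂ) (p : ℂ[X]) : ℂ[X] :=
  (Polynomial.X - Polynomial.C c) * p.derivative

lemma eulerAt_X_sub_C_pow_mul (c : ℂ) (a : ℕ) (u : ℂ[X]) :
    eulerAt c ((Polynomial.X - Polynomial.C c) ^ a * u) =
      (Polynomial.X - Polynomial.C c) ^ a * ((a : ℂ[X]) * u + eulerAt c u) := by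
  rcases a with _ | a
  · simp [eulerAt]
  · simp only [eulerAt, Polynomial.derivative_mul, Polynomial.derivative_X_sub_C_pow,
      Nat.add_sub_cancel, map_natCast]
    ring

lemma eval_eulerAt (c : ℂ) (p : ℂ[X]) : (eulerAt c p).eval c = 0 := by
  simp [eulerAt]

lemma eulerAt_natCast_mul_add (c : ℂ) (a : ℕ) (u : ℂ[X]) :
    eulerAt c (a * u + eulerAt c u) = a * eulerAt c u + eulerAt c (eulerAt c u) := by
  simp only [eulerAt, Polynomial.derivative_mul, Polynomial.derivative_add,
    Polynomial.derivative_natCast]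
  ring

lemma exists_eq_X_sub_C_pow_mul {p : ℂ[X]} (hp : p ≠ 0) (c : ℂ) :
    ∃ u : ℂ[X], p = (Polynomial.X - Polynomial.C c) ^ p.rootMultiplicity c * u ∧ u.eval c ≠ 0 := by
  obtain ⟨u, hu, hdvd⟩ := p.exists_eq_pow_rootMultiplicity_mul_and_not_dvd hp c
  exact ⟨u, hu, fun h => hdvd (Polynomial.dvd_iff_isRoot.mpr h)⟩

lemma rootMultiplicity_le_natDegree (p : ℂ[X]) (c : ℂ) :
    p.rootMultiplicity c ≤ p.natDegree := by
  rw [← Polynomial.count_roots]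
  exact (Multiset.count_le_card _ _).trans p.card_roots'

lemma natCast_mul_rootMultiplicity_eq {F W : ℂ[X]} (hF : F ≠ 0) (hW : W ≠ 0) {m n : ℕ}
    (h : m * (F * W.derivative) = n * (F.derivative * W)) (c : ℂ) :
    m * W.rootMultiplicity c = n * F.rootMultiplicity c := by
  obtain ⟨u, hu, huc⟩ := exists_eq_X_sub_C_pow_mul hF c
  obtain ⟨v, hv, hvc⟩ := exists_eq_X_sub_C_pow_mul hW c
  set a := F.rootMultiplicity c
  set w := W.rootMultiplicity c
  have hθF := eulerAt_X_sub_C_pow_mul c a u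
  have hθW := eulerAt_X_sub_C_pow_mul c w v
  rw [← hu] at hθF
  rw [← hv] at hθW
  have h1 : (m : ℂ[X]) * (F * eulerAt c W) = n * (eulerAt c F * W) := by
    simp only [eulerAt]
    linear_combination (Polynomial.X - Polynomial.C c) * h
  rw [hθF, hθW] at h1
  have h2 : (Polynomial.X - Polynomial.C c : ℂ[X]) ^ (a + w) * (m * (u * (w * v + eulerAt c v))) =
      (Polynomial.X - Polynomial.C c : ℂ[X]) ^ (a + w) * (n * ((a * u + eulerAt c u) * v)) := by
    rw [pow_add]
    linear_combination h1 - m * (Polynomial.X - Polynomial.C c : ℂ[X]) ^ w *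
      (w * v + eulerAt c v) * hu
      + n * (Polynomial.X - Polynomial.C c : ℂ[X]) ^ a * (a * u + eulerAt c u) * hv
  have h3 := congrArg (Polynomial.eval c)
    (mul_left_cancel₀ (pow_ne_zero _ (Polynomial.X_sub_C_ne_zero c)) h2)
  simp only [Polynomial.eval_mul, Polynomial.eval_add, Polynomial.eval_natCast, eval_eulerAt,
    add_zero] at h3
  have h4 : (m * w : ℂ) = n * a := by
    apply mul_right_cancel₀ (mul_ne_zero huc hvc)
    linear_combination h3
  exact_mod_cast h4

lemma TransvectantZero.indicial {d : ℕ} {F G : ℂ[X]} (h : TransvectantZero d F G) (hF : F ≠ 0)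
    (hG : G ≠ 0) (c : ℂ) {a p : ℕ} (ha : F.rootMultiplicity c = a)
    (hp : G.rootMultiplicity c = p) :
    (d : ℤ) * (p * (p - 1) + a * (a - 1)) = 2 * (d - 1) * (a * p) := by
  obtain ⟨u, hu, huc⟩ := exists_eq_X_sub_C_pow_mul hF c
  obtain ⟨v, hv, hvc⟩ := exists_eq_X_sub_C_pow_mul hG c
  rw [ha] at hu
  rw [hp] at hv
  have hθF := eulerAt_X_sub_C_pow_mul c a u
  have hθG := eulerAt_X_sub_C_pow_mul c p v
  have hθθF := eulerAt_X_sub_C_pow_mul c a (a * u + eulerAt c u)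
  have hθθG := eulerAt_X_sub_C_pow_mul c p (p * v + eulerAt c v)
  rw [← hθF, eulerAt_natCast_mul_add] at hθθF
  rw [← hθG, eulerAt_natCast_mul_add] at hθθG
  rw [← hu] at hθF hθθF
  rw [← hv] at hθG hθθG
  have h1 : (d : ℂ[X]) * (F * (eulerAt c (eulerAt c G) - eulerAt c G) +
      (eulerAt c (eulerAt c F) - eulerAt c F) * G) =
        2 * (d - 1) * (eulerAt c F * eulerAt c G) := by
    unfold TransvectantZero at h
    simp only [eulerAt, Polynomial.derivative_mul, Polynomial.derivative_X_sub_C]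
    linear_combination (Polynomial.X - Polynomial.C c : ℂ[X]) ^ 2 * h
  rw [hθθF, hθθG, hθF, hθG] at h1
  nth_rewrite 1 [hu] at h1
  nth_rewrite 1 [hv] at h1
  have h2 : (Polynomial.X - Polynomial.C c : ℂ[X]) ^ (a + p) *
      (d * (u * (p * (p * v + eulerAt c v) + (p * eulerAt c v + eulerAt c (eulerAt c v)) -
        (p * v + eulerAt c v)) +
        (a * (a * u + eulerAt c u) + (a * eulerAt c u + eulerAt c (eulerAt c u)) -
          (a * u + eulerAt c u)) * v)) =
      (Polynomial.X - Polynomial.C c : ℂ[X]) ^ (a + p) *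
        (2 * (d - 1) * ((a * u + eulerAt c u) * (p * v + eulerAt c v))) := by
    rw [pow_add]
    linear_combination h1
  have h3 := congrArg (Polynomial.eval c)
    (mul_left_cancel₀ (pow_ne_zero _ (Polynomial.X_sub_C_ne_zero c)) h2)
  simp only [Polynomial.eval_mul, Polynomial.eval_add, Polynomial.eval_sub, Polynomial.eval_ofNat,
    Polynomial.eval_one, Polynomial.eval_natCast, eval_eulerAt, add_zero, mul_zero] at h3
  have h4 : (d : ℂ) * (p * (p - 1) + a * (a - 1)) = 2 * (d - 1) * (a * p) := by
    apply mul_right_cancel₀ (mul_ne_zero huc hvc)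
    linear_combination h3
  exact_mod_cast h4

/-! ### The kernel is at most two-dimensional -/

/-- The value and the derivative at `c` of the dehomogenization. -/
noncomputable def jetAt (c : ℂ) : MvPolynomial (Fin 2) ℂ →ₗ[ℂ] ℂ × ℂ :=
  LinearMap.prod (Polynomial.leval c ∘ₗ dehom.toLinearMap)
    (Polynomial.leval c ∘ₗ Polynomial.derivative ∘ₗ dehom.toLinearMap)

@[simp] lemma jetAt_apply (c : ℂ) (g : MvPolynomial (Fin 2) ℂ) :
    jetAt c g = ((dehom g).eval c, (dehom g).derivative.eval c) := rfl

lemma TransvectantZero.eq_zero {d : ℕ} (hd : d ≠ 0) {F G : ℂ[X]} (h : TransvectantZero d F G)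
    {c : ℂ} (hF : F.eval c ≠ 0) (h0 : G.eval c = 0) (h1 : G.derivative.eval c = 0) : G = 0 := by
  by_contra hG
  have hF0 : F ≠ 0 := by rintro rfl; simp at hF
  have hp : 1 < G.rootMultiplicity c :=
    (Polynomial.one_lt_rootMultiplicity_iff_isRoot hG).mpr ⟨h0, h1⟩
  have := h.indicial hF0 hG c (Polynomial.rootMultiplicity_eq_zero hF) rfl
  simp only [Nat.cast_zero, zero_mul, add_zero, mul_zero, mul_eq_zero] at this
  omega

lemma jetAt_injective_on_kerDH2 {d : ℕ} (hd : 2 ≤ d) {f : MvPolynomial (Fin 2) ℂ}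
    (hf : f.IsHomogeneous d) {c : ℂ} (hc : (dehom f).eval c ≠ 0) :
    Function.Injective ((jetAt c).domRestrict (kerDH2 d f)) := by
  rw [injective_iff_map_eq_zero]
  rintro ⟨g, hg⟩ h
  simp only [LinearMap.domRestrict_apply, jetAt_apply, Prod.mk_eq_zero] at h
  ext1
  exact eq_zero_of_dehom_eq_zero (mem_kerDH2_iff.mp hg).1
    ((transvectantZero_of_mem_kerDH2 hd hf hg).eq_zero (by omega) hc h.1 h.2)

lemma finite_kerDH2 (d : ℕ) (f : MvPolynomial (Fin 2) ℂ) : Module.Finite ℂ (kerDH2 d f) := by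
  have : Module.Finite ℂ (homogeneousSubmodule (Fin 2) ℂ d) :=
    Module.Finite.iff_fg.mpr (homogeneousSubmodule_fg (σ := Fin 2) (R := ℂ) d)
  exact Submodule.finiteDimensional_inf_left _ _

lemma exists_eval_dehom_ne_zero {d : ℕ} {f : MvPolynomial (Fin 2) ℂ} (hf : f.IsHomogeneous d)
    (h0 : f ≠ 0) : ∃ c : ℂ, (dehom f).eval c ≠ 0 := by
  by_contra! h
  exact h0 (eq_zero_of_dehom_eq_zero hf (Polynomial.funext (by simpa using h)))

lemma finrank_kerDH2_le_two {d : ℕ} (hd : 2 ≤ d) {f : MvPolynomial (Fin 2) ℂ}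
    (hf : f.IsHomogeneous d) (h0 : f ≠ 0) : Module.finrank ℂ (kerDH2 d f) ≤ 2 := by
  obtain ⟨c, hc⟩ := exists_eval_dehom_ne_zero hf h0
  simpa using LinearMap.finrank_le_finrank_of_injective (jetAt_injective_on_kerDH2 hd hf hc)

/-! ### Forms with a two-dimensional kernel -/

lemma exists_wronskian {d : ℕ} (hd : 2 ≤ d) {f : MvPolynomial (Fin 2) ℂ}
    (hf : f.IsHomogeneous d) (h0 : f ≠ 0) (h2 : Module.finrank ℂ (kerDH2 d f) = 2) :
    ∃ W : ℂ[X], W ≠ 0 ∧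
      d * (dehom f * W.derivative) = (2 * (d - 1) : ℕ) * ((dehom f).derivative * W) := by
  obtain ⟨c, hc⟩ := exists_eval_dehom_ne_zero hf h0
  have := finite_kerDH2 d f
  have hsurj := (LinearMap.injective_iff_surjective_of_finrank_eq_finrank
    (by simpa using h2)).mp (jetAt_injective_on_kerDH2 hd hf hc)
  obtain ⟨⟨g₁, hg₁⟩, e₁⟩ := hsurj (1, 0)
  obtain ⟨⟨g₂, hg₂⟩, e₂⟩ := hsurj (0, 1)
  simp only [LinearMap.domRestrict_apply, jetAt_apply, Prod.mk.injEq] at e₁ e₂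
  have t₁ := transvectantZero_of_mem_kerDH2 hd hf hg₁
  have t₂ := transvectantZero_of_mem_kerDH2 hd hf hg₂
  refine ⟨dehom g₁ * (dehom g₂).derivative - (dehom g₁).derivative * dehom g₂, ?_, ?_⟩
  · intro h
    simpa [e₁, e₂] using congrArg (Polynomial.eval c) h
  · unfold TransvectantZero at t₁ t₂
    rw [Nat.cast_mul, Nat.cast_sub (by omega : 1 ≤ d)]
    simp only [Polynomial.derivative_sub, Polynomial.derivative_mul, Nat.cast_ofNat, Nat.cast_one]
    linear_combination dehom g₁ * t₂ - dehom g₂ * t₁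

lemma two_mul_rootMultiplicity_eq {d : ℕ} (hd : 2 ≤ d) {f : MvPolynomial (Fin 2) ℂ}
    (hf : f.IsHomogeneous d) (h0 : f ≠ 0) (h2 : Module.finrank ℂ (kerDH2 d f) = 2) {c : ℂ}
    (hc : (dehom f).IsRoot c) :
    2 * (dehom f).rootMultiplicity c = d ∨ (dehom f).rootMultiplicity c = d := by
  have hF : dehom f ≠ 0 := fun h => h0 (eq_zero_of_dehom_eq_zero hf h)
  obtain ⟨W, hW, h⟩ := exists_wronskian hd hf h0 h2
  have hm := natCast_mul_rootMultiplicity_eq hF hW h c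
  have hpos := (Polynomial.rootMultiplicity_pos hF).mpr hc
  have hle := (rootMultiplicity_le_natDegree (dehom f) c).trans (natDegree_dehom_le hf)
  set a := (dehom f).rootMultiplicity c
  have hdvd : d ∣ 2 * a := by
    obtain ⟨e, rfl⟩ : ∃ e, d = e + 1 := ⟨d - 1, by omega⟩
    rw [Nat.add_sub_cancel] at hm
    rw [← Nat.dvd_add_right (Dvd.intro _ hm)]
    exact ⟨2 * a, by ring⟩
  obtain ⟨k, hk⟩ := hdvd
  have : k ≤ 2 := by
    by_contra! hk3
    nlinarith
  interval_cases k <;> omega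

lemma dehom_ne_C_mul_X_sub_C_pow {d : ℕ} (hd : 1 ≤ d) {f : MvPolynomial (Fin 2) ℂ}
    (hf : f.IsHomogeneous d) (hH : hessDet f ≠ 0) (s c : ℂ) :
    dehom f ≠ Polynomial.C s * (Polynomial.X - Polynomial.C c) ^ d := by
  intro h
  refine hH (eq_zero_of_dehom_eq_zero (isHomogeneous_hessDet hf) ?_)
  rw [dehom_hessDet hd hf, h]
  rcases d with _ | _ | e
  · omega
  · simp
  · simp only [Polynomial.derivative_C, Polynomial.derivative_X_sub_C_pow, map_natCast,
      Polynomial.derivative_mul, Polynomial.derivative_natCast, Nat.add_sub_cancel, zero_mul,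
      zero_add]
    push_cast
    ring

lemma dehom_ne_C {d : ℕ} (hd : 1 ≤ d) {f : MvPolynomial (Fin 2) ℂ}
    (hf : f.IsHomogeneous d) (hH : hessDet f ≠ 0) (s : ℂ) : dehom f ≠ Polynomial.C s := by
  intro h
  refine hH (eq_zero_of_dehom_eq_zero (isHomogeneous_hessDet hf) ?_)
  rw [dehom_hessDet hd hf, h]
  simp

lemma eq_C_of_forall_not_isRoot {p : ℂ[X]} (h : ∀ c, ¬ p.IsRoot c) : ∃ s, p = Polynomial.C s := by
  refine ⟨p.coeff 0, Polynomial.eq_C_of_degree_le_zero ?_⟩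
  by_contra! hp
  obtain ⟨c, hc⟩ := IsAlgClosed.exists_root p hp.ne'
  exact h c hc

lemma isHomogeneous_X_sub_C_mul_X (c : ℂ) :
    (X 0 - C c * X 1 : MvPolynomial (Fin 2) ℂ).IsHomogeneous 1 :=
  (isHomogeneous_X _ _).sub (isHomogeneous_C_mul_X _ _)

lemma exists_eq_pow_mul_pow {d : ℕ} (hd : 2 ≤ d) {f : MvPolynomial (Fin 2) ℂ}
    (hf : f.IsHomogeneous d) (hH : hessDet f ≠ 0) (h0 : f ≠ 0)
    (h2 : Module.finrank ℂ (kerDH2 d f) = 2) :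
    ∃ (a : ℕ) (c s : ℂ) (ℓ : MvPolynomial (Fin 2) ℂ), d = 2 * a ∧
      (dehom f).rootMultiplicity c = a ∧ ℓ.IsHomogeneous 1 ∧ s ≠ 0 ∧
      LinearIndependent ℂ ![X 0 - C c * X 1, ℓ] ∧
      f = C s * ((X 0 - C c * X 1) ^ a * ℓ ^ a) := by
  have hF : dehom f ≠ 0 := fun h => h0 (eq_zero_of_dehom_eq_zero hf h)
  obtain ⟨c, hc⟩ : ∃ c, (dehom f).IsRoot c := by
    by_contra! h
    obtain ⟨s, hs⟩ := eq_C_of_forall_not_isRoot h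
    exact dehom_ne_C (by omega) hf hH s hs
  obtain ⟨u, hu, huc⟩ := exists_eq_X_sub_C_pow_mul hF c
  have hu0 : u ≠ 0 := by rintro rfl; simp at huc
  have hdeg : (dehom f).rootMultiplicity c + u.natDegree ≤ d := by
    refine le_trans (le_of_eq ?_) (natDegree_dehom_le hf)
    conv_rhs => rw [hu]
    rw [Polynomial.natDegree_mul (pow_ne_zero _ (Polynomial.X_sub_C_ne_zero c)) hu0,
      Polynomial.natDegree_pow, Polynomial.natDegree_X_sub_C, mul_one]
  have hne : (dehom f).rootMultiplicity c ≠ d := by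
    intro h
    obtain ⟨s, hs⟩ : ∃ s, u = Polynomial.C s :=
      ⟨_, Polynomial.eq_C_of_natDegree_le_zero (by omega)⟩
    rw [h, hs, mul_comm] at hu
    exact dehom_ne_C_mul_X_sub_C_pow (by omega) hf hH s c hu
  have ha := (two_mul_rootMultiplicity_eq hd hf h0 h2 hc).resolve_right hne
  set a := (dehom f).rootMultiplicity c
  by_cases hroot : ∃ b, u.IsRoot b
  · obtain ⟨b, hb⟩ := hroot
    have hbc : b ≠ c := by rintro rfl; exact huc hb
    have hbF : (dehom f).IsRoot b := by
      rw [hu]; exact Polynomial.IsRoot.def.mpr (by rw [Polynomial.eval_mul, hb.eq_zero, mul_zero])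
    have hmult : (dehom f).rootMultiplicity b = u.rootMultiplicity b := by
      conv_lhs => rw [hu]
      rw [Polynomial.rootMultiplicity_mul (hu ▸ hF), Polynomial.rootMultiplicity_eq_zero, zero_add]
      simp [Polynomial.IsRoot, sub_eq_zero, hbc]
    have hule := rootMultiplicity_le_natDegree u b
    have hmb : u.rootMultiplicity b = a := by
      have := two_mul_rootMultiplicity_eq hd hf h0 h2 hbF
      omega
    obtain ⟨v, hv, hvb⟩ := exists_eq_X_sub_C_pow_mul hu0 b
    have hv0 : v ≠ 0 := by rintro rfl; simp at hvb
    have hvdeg : u.natDegree = a + v.natDegree := by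
      conv_lhs => rw [hv]
      rw [Polynomial.natDegree_mul (pow_ne_zero _ (Polynomial.X_sub_C_ne_zero b)) hv0,
        Polynomial.natDegree_pow, Polynomial.natDegree_X_sub_C, mul_one, hmb]
    obtain ⟨s, rfl⟩ : ∃ s, v = Polynomial.C s :=
      ⟨_, Polynomial.eq_C_of_natDegree_le_zero (by omega)⟩
    refine ⟨a, c, s, X 0 - C b * X 1, ha.symm, rfl, isHomogeneous_X_sub_C_mul_X b, ?_, ?_, ?_⟩
    · rintro rfl; simp at hv0
    · rw [LinearIndependent.pair_iff]
      intro p q hpq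
      have e := congrArg dehom hpq
      simp only [map_add, map_smul, map_sub, map_mul, dehom_X_zero, dehom_X_one, dehom_C, mul_one,
        map_zero] at e
      have ec := congrArg (Polynomial.eval c) e
      have eb := congrArg (Polynomial.eval b) e
      simp [sub_eq_zero, hbc, hbc.symm] at ec eb
      exact ⟨eb, ec⟩
    · refine eq_of_dehom_eq hf ?_ ?_
      · have := (((isHomogeneous_X_sub_C_mul_X c).pow a).mul
          ((isHomogeneous_X_sub_C_mul_X b).pow a)).C_mul s
        rwa [show 1 * a + 1 * a = d by omega] at this
      · rw [hmb] at hv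
        conv_lhs => rw [hu, hv]
        simp
        ring
  · push Not at hroot
    obtain ⟨s, rfl⟩ := eq_C_of_forall_not_isRoot hroot
    refine ⟨a, c, s, X 1, ha.symm, rfl, isHomogeneous_X _ _, ?_, ?_, ?_⟩
    · rintro rfl; simp at hu0
    · rw [LinearIndependent.pair_iff]
      intro p q hpq
      have e := congrArg dehom hpq
      simp only [map_add, map_smul, map_sub, map_mul, dehom_X_zero, dehom_X_one, dehom_C, mul_one,
        map_zero] at e
      have ec := congrArg (Polynomial.eval c) e
      have eb := congrArg (Polynomial.eval (c + 1)) e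
      simp at ec eb
      simp [ec] at eb
      exact ⟨eb, ec⟩
    · refine eq_of_dehom_eq hf ?_ ?_
      · have := (((isHomogeneous_X_sub_C_mul_X c).pow a).mul
          ((isHomogeneous_X ℂ (1 : Fin 2)).pow a)).C_mul s
        rwa [show 1 * a + 1 * a = d by omega] at this
      · conv_lhs => rw [hu]
        simp
        ring

lemma exists_sq_eq_of_finrank_eq_two {d : ℕ} (hd : 2 ≤ d) {f : MvPolynomial (Fin 2) ℂ}
    (hf : f.IsHomogeneous d) (h0 : f ≠ 0) (h2 : Module.finrank ℂ (kerDH2 d f) = 2)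
    {a : ℕ} {c : ℂ} (hda : d = 2 * a) (ha : (dehom f).rootMultiplicity c = a) :
    ∃ m : ℕ, a = m ^ 2 := by
  have hF : dehom f ≠ 0 := fun h => h0 (eq_zero_of_dehom_eq_zero hf h)
  have : Nontrivial (kerDH2 d f) := Module.nontrivial_of_finrank_pos (R := ℂ) (by omega)
  obtain ⟨⟨g, hg⟩, hg0⟩ := exists_ne (0 : kerDH2 d f)
  have hG : dehom g ≠ 0 := fun h =>
    hg0 (Subtype.ext (eq_zero_of_dehom_eq_zero (mem_kerDH2_iff.mp hg).1 h))
  have h := (transvectantZero_of_mem_kerDH2 hd hf hg).indicial hF hG c ha rfl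
  set p := (dehom g).rootMultiplicity c
  refine ⟨((p : ℤ) - a).natAbs, ?_⟩
  zify
  rw [sq_abs]
  have ha0 : (2 * a : ℤ) ≠ 0 := by omega
  apply mul_left_cancel₀ ha0
  rw [hda] at h
  push_cast at h
  linear_combination -h

/-! ### Powers of a product of two linear forms -/

lemma exists_pderiv_eq_C {ℓ : MvPolynomial (Fin 2) ℂ} (h : ℓ.IsHomogeneous 1) (i : Fin 2) :
    ∃ α, pderiv i ℓ = C α :=
  ⟨_, totalDegree_eq_zero_iff_eq_C.mp ((totalDegree_zero_iff_isHomogeneous _).mpr h.pderiv)⟩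

lemma exists_eq_C_mul_X_add {ℓ : MvPolynomial (Fin 2) ℂ} (h : ℓ.IsHomogeneous 1) :
    ∃ α β, ℓ = C α * X 0 + C β * X 1 := by
  obtain ⟨α, hα⟩ := exists_pderiv_eq_C h 0
  obtain ⟨β, hβ⟩ := exists_pderiv_eq_C h 1
  have := h.sum_X_mul_pderiv
  rw [Fin.sum_univ_two, hα, hβ, one_smul] at this
  exact ⟨α, β, by rw [← this]; ring⟩

lemma dH2_pow_mul_pow (α β γ δ : ℂ) (a p q : ℕ) {ℓ₁ ℓ₂ : MvPolynomial (Fin 2) ℂ}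
    (h₁ : ℓ₁ = C α * X 0 + C β * X 1) (h₂ : ℓ₂ = C γ * X 0 + C δ * X 1) :
    dH2 (ℓ₁ ^ (a + 2) * ℓ₂ ^ (a + 2)) (ℓ₁ ^ (p + 2) * ℓ₂ ^ (q + 2)) =
      ((a + 2) * (a + 1) * ((q + 2) * (q + 1) + (p + 2) * (p + 1)) -
          2 * (a + 2) ^ 2 * ((p + 2) * (q + 2))) *
        (C α * C δ - C β * C γ : MvPolynomial (Fin 2) ℂ) ^ 2 *
        (ℓ₁ ^ (a + p + 2) * ℓ₂ ^ (a + q + 2)) := by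
  have d10 : pderiv 0 ℓ₁ = C α := by simp [h₁, pderiv_X]
  have d11 : pderiv 1 ℓ₁ = C β := by simp [h₁, pderiv_X]
  have d20 : pderiv 0 ℓ₂ = C γ := by simp [h₂, pderiv_X]
  have d21 : pderiv 1 ℓ₂ = C δ := by simp [h₂, pderiv_X]
  simp only [dH2, LinearMap.sub_apply, LinearMap.add_apply, LinearMap.comp_apply,
    LinearMap.mulLeft_apply, Derivation.coeFn_coe,
    pderiv_mul, pderiv_pow, d10, d11, d20, d21, pderiv_C, map_add, Derivation.map_natCast,
    Nat.add_sub_cancel, show ∀ n : ℕ, n + 2 - 1 = n + 1 from fun _ => rfl]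
  push_cast
  ring

lemma pow_mul_pow_mem_kerDH2 {ℓ₁ ℓ₂ : MvPolynomial (Fin 2) ℂ} (h₁ : ℓ₁.IsHomogeneous 1)
    (h₂ : ℓ₂.IsHomogeneous 1) {m p q : ℕ} (hp : 2 ≤ p) (hq : 2 ≤ q)
    (hpq : p + q = 2 * m ^ 2) (hmul : p * q = m ^ 2 * (m ^ 2 - 1)) :
    ℓ₁ ^ p * ℓ₂ ^ q ∈ kerDH2 (2 * m ^ 2) (ℓ₁ ^ (m ^ 2) * ℓ₂ ^ (m ^ 2)) := by
  rw [mem_kerDH2_iff]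
  constructor
  · have := (h₁.pow p).mul (h₂.pow q)
    rwa [one_mul, one_mul, hpq] at this
  · obtain ⟨α, β, e₁⟩ := exists_eq_C_mul_X_add h₁
    obtain ⟨γ, δ, e₂⟩ := exists_eq_C_mul_X_add h₂
    have ha : 2 ≤ m ^ 2 := by omega
    obtain ⟨a, ha⟩ := Nat.exists_eq_add_of_le' ha
    obtain ⟨p, rfl⟩ := Nat.exists_eq_add_of_le' hp
    obtain ⟨q, rfl⟩ := Nat.exists_eq_add_of_le' hq
    rw [ha] at hpq hmul ⊢
    rw [dH2_pow_mul_pow α β γ δ a p q e₁ e₂]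
    rw [show a + 2 - 1 = a + 1 from rfl] at hmul
    have hs : (p + q : MvPolynomial (Fin 2) ℂ) = 2 * a := by
      exact_mod_cast (by omega : p + q = 2 * a)
    have ht : ((p + 2) * (q + 2) : MvPolynomial (Fin 2) ℂ) = (a + 2) * (a + 1) := by
      exact_mod_cast hmul
    have : ((a + 2) * (a + 1) * ((q + 2) * (q + 1) + (p + 2) * (p + 1)) -
          2 * (a + 2) ^ 2 * ((p + 2) * (q + 2)) : MvPolynomial (Fin 2) ℂ) = 0 := by
      linear_combination ((a + 2) * (a + 1) * (p + q + 2 * a + 7)) * hs -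
        (2 * (a + 2) * (a + 1) + 2 * (a + 2) ^ 2) * ht
    rw [this, zero_mul, zero_mul]

lemma det_ne_zero_of_linearIndependent {α β γ δ : ℂ}
    (h : LinearIndependent ℂ ![(C α * X 0 + C β * X 1 : MvPolynomial (Fin 2) ℂ),
      C γ * X 0 + C δ * X 1]) : α * δ - β * γ ≠ 0 := by
  intro hdet
  rw [LinearIndependent.pair_iff] at h
  have hC : (C α * C δ - C β * C γ : MvPolynomial (Fin 2) ℂ) = 0 := by
    rw [← C_mul, ← C_mul, ← C_sub, hdet, C_0]
  obtain ⟨hδ, hβ⟩ := h δ (-β) (by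
    simp only [smul_eq_C_mul, map_neg]
    linear_combination X 0 * hC)
  obtain ⟨hγ, hα⟩ := h γ (-α) (by
    simp only [smul_eq_C_mul, map_neg]
    linear_combination -X 1 * hC)
  have := h 1 0 (by simp [neg_eq_zero.mp hα, neg_eq_zero.mp hβ])
  exact one_ne_zero this.1

lemma linearIndependent_pow_mul_pow {ℓ₁ ℓ₂ : MvPolynomial (Fin 2) ℂ} (h₁ : ℓ₁.IsHomogeneous 1)
    (h₂ : ℓ₂.IsHomogeneous 1) (hli : LinearIndependent ℂ ![ℓ₁, ℓ₂]) (k : ℕ) {n : ℕ}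
    (hn : n ≠ 0) :
    LinearIndependent ℂ ![ℓ₁ ^ (k + n) * ℓ₂ ^ k, ℓ₁ ^ k * ℓ₂ ^ (k + n)] := by
  have n₁ : ℓ₁ ≠ 0 := hli.ne_zero 0
  have n₂ : ℓ₂ ≠ 0 := hli.ne_zero 1
  obtain ⟨α, β, e₁⟩ := exists_eq_C_mul_X_add h₁
  obtain ⟨γ, δ, e₂⟩ := exists_eq_C_mul_X_add h₂
  have hdet : α * δ - β * γ ≠ 0 := det_ne_zero_of_linearIndependent (by rwa [← e₁, ← e₂])
  rw [LinearIndependent.pair_iff]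
  intro s t hst
  have h : C s * ℓ₁ ^ n + C t * ℓ₂ ^ n = 0 := by
    apply mul_left_cancel₀ (mul_ne_zero (pow_ne_zero k n₁) (pow_ne_zero k n₂))
    simp only [smul_eq_C_mul] at hst
    rw [mul_zero, ← hst]
    ring
  have key₁ := congrArg (eval ![β, -α]) h
  have key₂ := congrArg (eval ![δ, -γ]) h
  simp only [e₁, e₂, map_add, map_mul, map_pow, eval_C, eval_X, Matrix.cons_val_zero,
    Matrix.cons_val_one, map_zero] at key₁ key₂
  rw [show α * β + β * -α = 0 by ring, zero_pow hn, mul_zero, zero_add,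
    show γ * β + δ * -α = -(α * δ - β * γ) by ring] at key₁
  rw [show γ * δ + δ * -γ = 0 by ring, zero_pow hn, mul_zero, add_zero,
    show α * δ + β * -γ = α * δ - β * γ by ring] at key₂
  exact ⟨(mul_eq_zero.mp key₂).resolve_right (pow_ne_zero n hdet),
    (mul_eq_zero.mp key₁).resolve_right (pow_ne_zero n (neg_ne_zero.mpr hdet))⟩

lemma two_le_finrank_kerDH2_pow_mul_pow {ℓ₁ ℓ₂ : MvPolynomial (Fin 2) ℂ}
    (h₁ : ℓ₁.IsHomogeneous 1) (h₂ : ℓ₂.IsHomogeneous 1)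
    (hli : LinearIndependent ℂ ![ℓ₁, ℓ₂]) {m : ℕ} (hm : 2 ≤ m) :
    2 ≤ Module.finrank ℂ (kerDH2 (2 * m ^ 2) (ℓ₁ ^ (m ^ 2) * ℓ₂ ^ (m ^ 2))) := by
  obtain ⟨k, hk⟩ : ∃ k, m ^ 2 = k + m :=
    ⟨m ^ 2 - m, (Nat.sub_add_cancel (Nat.le_self_pow two_ne_zero m)).symm⟩
  have hk2 : 2 ≤ k := by nlinarith
  have hsum : k + 2 * m + k = 2 * m ^ 2 := by omega
  have hprod : (k + 2 * m) * k = m ^ 2 * (m ^ 2 - 1) := by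
    obtain ⟨b, hb⟩ : ∃ b, m ^ 2 = b + 1 := ⟨m ^ 2 - 1, by omega⟩
    rw [hb, Nat.add_sub_cancel]
    zify at hb hk ⊢
    linear_combination (-(m : ℤ) ^ 2 - k - m) * hk + ((m : ℤ) ^ 2 + b) * hb
  have mem₁ := pow_mul_pow_mem_kerDH2 h₁ h₂ (m := m) (p := k + 2 * m) (q := k) (by omega) hk2
    hsum hprod
  have mem₂ := pow_mul_pow_mem_kerDH2 h₁ h₂ (m := m) (p := k) (q := k + 2 * m) hk2 (by omega)
    (by omega) (by rw [mul_comm, hprod])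
  have hind := linearIndependent_pow_mul_pow h₁ h₂ hli k (n := 2 * m) (by omega)
  have := finite_kerDH2 (2 * m ^ 2) (ℓ₁ ^ (m ^ 2) * ℓ₂ ^ (m ^ 2))
  have hind' : LinearIndependent ℂ
      ![(⟨_, mem₁⟩ : kerDH2 (2 * m ^ 2) (ℓ₁ ^ (m ^ 2) * ℓ₂ ^ (m ^ 2))), ⟨_, mem₂⟩] := by
    rw [LinearIndependent.pair_iff] at hind ⊢
    intro s t hst
    exact hind s t (congrArg Subtype.val hst)
  simpa using hind'.fintype_card_le_finrank

/-- For `d ≥ 3` and `f` a binary form of degree `d` with `H(f) ≠ 0`: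
`dim Ker(dH_f) ≤ 1`, unless `d = 2m²` and `f = ℓ_1^{m²}ℓ_2^{m²}` for linearly
independent linear forms `ℓ_1, ℓ_2`; in the latter case `dim Ker(dH_f) = 2`. -/
theorem ker_dH_binary_forms (d : ℕ) (hd : 3 ≤ d) (f : MvPolynomial (Fin 2) ℂ)
    (hf : f.IsHomogeneous d) (hH : hessDet f ≠ 0) :
    (¬ (∃ (m : ℕ) (ℓ₁ ℓ₂ : MvPolynomial (Fin 2) ℂ), d = 2 * m ^ 2 ∧
        ℓ₁.IsHomogeneous 1 ∧ ℓ₂.IsHomogeneous 1 ∧ LinearIndependent ℂ ![ℓ₁, ℓ₂] ∧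
        f = ℓ₁ ^ (m ^ 2) * ℓ₂ ^ (m ^ 2)) →
      Module.finrank ℂ ↥(kerDH2 d f) ≤ 1) ∧
    ((∃ (m : ℕ) (ℓ₁ ℓ₂ : MvPolynomial (Fin 2) ℂ), d = 2 * m ^ 2 ∧
        ℓ₁.IsHomogeneous 1 ∧ ℓ₂.IsHomogeneous 1 ∧ LinearIndependent ℂ ![ℓ₁, ℓ₂] ∧
        f = ℓ₁ ^ (m ^ 2) * ℓ₂ ^ (m ^ 2)) →
      Module.finrank ℂ ↥(kerDH2 d f) = 2) := by
  have h0 : f ≠ 0 := by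
    rintro rfl
    simp [hessDet, Matrix.det_fin_two] at hH
  have hle := finrank_kerDH2_le_two (by omega) hf h0
  constructor
  · intro hnot
    by_contra! hlt
    have h2 : Module.finrank ℂ (kerDH2 d f) = 2 := by omega
    obtain ⟨a, c, s, ℓ, hda, ha, hℓ, hs, hli, hfac⟩ :=
      exists_eq_pow_mul_pow (by omega) hf hH h0 h2
    obtain ⟨m, rfl⟩ := exists_sq_eq_of_finrank_eq_two (by omega) hf h0 h2 hda ha
    obtain ⟨r, hr⟩ := IsAlgClosed.exists_pow_nat_eq s (n := m ^ 2) (by omega)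
    have hr0 : r ≠ 0 := by
      rintro rfl
      exact hs (by rw [← hr, zero_pow (by omega)])
    refine hnot ⟨m, X 0 - C c * X 1, C r * ℓ, hda, isHomogeneous_X_sub_C_mul_X c,
      hℓ.C_mul r, ?_, ?_⟩
    · rw [LinearIndependent.pair_iff] at hli ⊢
      intro p q hpq
      obtain ⟨hp, hq⟩ := hli p (q * r) (by rw [← hpq, mul_smul, smul_eq_C_mul ℓ r])
      exact ⟨hp, (mul_eq_zero.mp hq).resolve_right hr0⟩
    · rw [hfac, mul_pow, ← C_pow, hr]
      ring
  · rintro ⟨m, ℓ₁, ℓ₂, rfl, h₁, h₂, hli, rfl⟩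
    have hm : 2 ≤ m := by
      by_contra! h
      interval_cases m <;> omega
    exact le_antisymm hle (two_le_finrank_kerDH2_pow_mul_pow h₁ h₂ hli hm)
end
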